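/- Let j ∈ ℤ, A ≥ 0, f ∈ E_A and n, m > 2A. Then the operators commute: S_{m,j}(S_{n,j} f) = S_{n,j}(S_{m,j} f) on [0,∞). -/

import Mathlib

open MeasureTheory Real Filter Asymptotics

/-- The basis functions `s_{n,k}(x) = (nx)^k / k! · e^{-nx}` for `k ≥ 0`, and `0` for `k < 0`. -/
noncomputable def szk (n : ℝ) (k : ℤ) (x : ℝ) : ℝ :=
  if k < 0 then 0 else (n * x) ^ k.toNat / (Nat.factorial k.toNat) * Real.exp (-n * x)

/-- Membership in `E_A`: locally integrable on `[0,∞)` and `|f t| ≤ K e^{A t}` for some `K > 0`. -/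
def MemEA (A : ℝ) (f : ℝ → ℝ) : Prop :=
  LocallyIntegrableOn f (Set.Ici 0) volume ∧ ∃ K > 0, ∀ t ≥ (0:ℝ), |f t| ≤ K * Real.exp (A * t)

/-- The Szász-Mirakjan-Durrmeyer type operator `S_{n,j}`. -/
noncomputable def Snj (n : ℝ) (j : ℤ) (f : ℝ → ℝ) (x : ℝ) : ℝ :=
  f 0 * ∑ k ∈ Finset.range j.toNat, szk n k x
    + ∑' k : ℕ, szk n (max 0 j + k) x *
        (n * ∫ t in Set.Ioi (0:ℝ), szk n (max 0 j + k - j) t * f t)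

open ProbabilityTheory
open scoped ENNReal

lemma szk_natCast (n : ℝ) (k : ℕ) (x : ℝ) :
    szk n k x = (n * x) ^ k / k.factorial * Real.exp (-n * x) := by
  simp [szk]

lemma szk_nonneg {n x : ℝ} (hn : 0 ≤ n) (hx : 0 ≤ x) (k : ℤ) : 0 ≤ szk n k x := by
  unfold szk
  split_ifs
  · exact le_rfl
  · positivity

@[fun_prop]
lemma measurable_szk (n : ℝ) (k : ℤ) : Measurable (szk n k) := by
  unfold szk
  split_ifs <;> fun_prop

/-- The Gamma integral with integer exponent, as a Lebesgue integral. -/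
lemma lintegral_pow_mul_exp_neg {b : ℝ} (hb : 0 < b) (k : ℕ) :
    ∫⁻ t in Set.Ioi (0 : ℝ), ENNReal.ofReal (t ^ k * Real.exp (-b * t)) =
      ENNReal.ofReal (k.factorial / b ^ (k + 1)) := by
  have h := Real.integral_rpow_mul_exp_neg_mul_Ioi (a := k + 1) (by positivity) hb
  simp only [add_sub_cancel_right, Real.rpow_natCast, Real.Gamma_nat_eq_factorial] at h
  have hpos : 0 < (k.factorial : ℝ) / b ^ (k + 1) := by positivity
  have h' : ∫ t in Set.Ioi (0 : ℝ), t ^ k * Real.exp (-b * t) = k.factorial / b ^ (k + 1) := by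
    simp only [neg_mul]
    rw [h]
    norm_cast
    simp [div_eq_inv_mul]
  rw [← h', ofReal_integral_eq_lintegral_ofReal]
  · by_contra hi
    rw [integral_undef hi] at h'
    exact hpos.ne h'
  · filter_upwards [ae_restrict_mem measurableSet_Ioi] with t ht
    have : (0 : ℝ) < t := ht
    positivity

lemma tsum_ofReal_szk_mul_pow {n x r : ℝ} (hn : 0 ≤ n) (hx : 0 ≤ x) (hr : 0 ≤ r) :
    ∑' k : ℕ, ENNReal.ofReal (szk n k x) * ENNReal.ofReal (r ^ k) =
      ENNReal.ofReal (Real.exp (n * x * (r - 1))) := by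
  have h : HasSum (fun k : ℕ ↦ szk n k x * r ^ k) (Real.exp (n * x * (r - 1))) := by
    have := (NormedSpace.expSeries_div_hasSum_exp (n * x * r)).mul_right (Real.exp (-n * x))
    rw [← Real.exp_eq_exp_ℝ, ← Real.exp_add] at this
    rw [show n * x * (r - 1) = n * x * r + -n * x by ring]
    have e (k : ℕ) : szk n k x * r ^ k = (n * x * r) ^ k / k.factorial * Real.exp (-n * x) := by
      rw [szk_natCast, mul_pow _ r]
      ring
    simpa only [e] using this
  simp_rw [← ENNReal.ofReal_mul (szk_nonneg hn hx _)]
  rw [← ENNReal.ofReal_tsum_of_nonneg (fun k ↦ mul_nonneg (szk_nonneg hn hx _) (by positivity))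
    h.summable, h.tsum_eq]

lemma tsum_ofReal_szk {n x : ℝ} (hn : 0 ≤ n) (hx : 0 ≤ x) :
    ∑' k : ℕ, ENNReal.ofReal (szk n k x) = 1 := by
  simpa using tsum_ofReal_szk_mul_pow hn hx zero_le_one

lemma tsum_ofReal_pow_div_factorial {x : ℝ} (hx : 0 ≤ x) :
    ∑' k : ℕ, ENNReal.ofReal (x ^ k / k.factorial) = ENNReal.ofReal (Real.exp x) := by
  have h := NormedSpace.expSeries_div_hasSum_exp x
  rw [← Real.exp_eq_exp_ℝ] at h
  rw [← ENNReal.ofReal_tsum_of_nonneg (fun k ↦ by positivity) h.summable, h.tsum_eq]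

lemma lintegral_szk_mul_exp {n B : ℝ} (hn : 0 ≤ n) (hB : B < n) (i : ℕ) :
    ∫⁻ t in Set.Ioi (0 : ℝ), ENNReal.ofReal (n * szk n i t) * ENNReal.ofReal (Real.exp (B * t)) =
      ENNReal.ofReal ((n / (n - B)) ^ (i + 1)) := by
  have hb : 0 < n - B := sub_pos.2 hB
  have : ∀ t ∈ Set.Ioi (0 : ℝ),
      ENNReal.ofReal (n * szk n i t) * ENNReal.ofReal (Real.exp (B * t)) =
      ENNReal.ofReal (n ^ (i + 1) / i.factorial) *
        ENNReal.ofReal (t ^ i * Real.exp (-(n - B) * t)) := by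
    intro t ht
    rw [← ENNReal.ofReal_mul (mul_nonneg hn (szk_nonneg hn (le_of_lt ht) _)),
      ← ENNReal.ofReal_mul (by positivity), szk_natCast,
      show -(n - B) * t = -n * t + B * t by ring, Real.exp_add]
    congr 1
    ring
  rw [setLIntegral_congr_fun measurableSet_Ioi this, lintegral_const_mul _ (by fun_prop),
    lintegral_pow_mul_exp_neg hb, ← ENNReal.ofReal_mul (by positivity)]
  rw [div_pow, div_mul_div_cancel₀ (by positivity)]

lemma lintegral_szk_mul_szk {m n : ℝ} (hm : 0 < m) (hn : 0 < n) (i l : ℕ) :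
    ∫⁻ y in Set.Ioi (0 : ℝ), ENNReal.ofReal (m * szk m i y) * ENNReal.ofReal (szk n l y) =
      ENNReal.ofReal (m ^ (i + 1) * n ^ l * (i + l).factorial /
        (i.factorial * l.factorial * (m + n) ^ (i + l + 1))) := by
  have : ∀ t ∈ Set.Ioi (0 : ℝ),
      ENNReal.ofReal (m * szk m i t) * ENNReal.ofReal (szk n l t) =
      ENNReal.ofReal (m ^ (i + 1) * n ^ l / (i.factorial * l.factorial)) *
        ENNReal.ofReal (t ^ (i + l) * Real.exp (-(m + n) * t)) := by
    intro t ht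
    rw [← ENNReal.ofReal_mul (mul_nonneg hm.le (szk_nonneg hm.le (le_of_lt ht) _)),
      ← ENNReal.ofReal_mul (by positivity), szk_natCast, szk_natCast,
      show -(m + n) * t = -m * t + -n * t by ring, Real.exp_add]
    congr 1
    ring
  rw [setLIntegral_congr_fun measurableSet_Ioi this, lintegral_const_mul _ (by fun_prop),
    lintegral_pow_mul_exp_neg (by positivity), ← ENNReal.ofReal_mul (by positivity)]
  congr 1
  field_simp

/-- A form of Vandermonde's identity. -/
lemma sum_range_inv_factorial_eq (i a b : ℕ) :
    ∑ r ∈ Finset.range (b + 1), (if r ≤ a ∧ r ≤ b then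
        (1 : ℝ) / (r.factorial * (i + r).factorial * ((a - r).factorial * (b - r).factorial))
        else 0) =
      (a + (i + b)).factorial /
        (a.factorial * (i + b).factorial * ((i + a).factorial * b.factorial)) := by
  have h := Nat.add_choose_eq a (i + b) b
  rw [Finset.Nat.sum_antidiagonal_eq_sum_range_succ (fun p q ↦ a.choose p * (i + b).choose q)] at h
  have h' := congrArg (Nat.cast : ℕ → ℝ) h
  rw [Nat.cast_choose ℝ (by omega), show a + (i + b) - b = i + a by omega] at h'
  have e : ((a + (i + b)).factorial : ℝ) /
      (a.factorial * (i + b).factorial * ((i + a).factorial * b.factorial)) =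
      1 / (a.factorial * (i + b).factorial) *
        ((a + (i + b)).factorial / (b.factorial * (i + a).factorial)) := by
    field_simp
  rw [e, h', Nat.cast_sum, Finset.mul_sum]
  refine Finset.sum_congr rfl fun r hr ↦ ?_
  have hrb : r ≤ b := Nat.lt_succ_iff.1 (Finset.mem_range.1 hr)
  by_cases hra : r ≤ a
  · rw [if_pos ⟨hra, hrb⟩, Nat.cast_mul, Nat.cast_choose ℝ hra, Nat.cast_choose ℝ (by omega),
      show i + b - (b - r) = i + r by omega]
    field_simp
  · simp [hra, Nat.choose_eq_zero_of_lt (not_le.1 hra)]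

lemma ENNReal.tsum_eq_tsum_add_of_eq_zero {g : ℕ → ℝ≥0∞} (J : ℕ) (h : ∀ k < J, g k = 0) :
    ∑' k, g k = ∑' k, g (J + k) := by
  refine ((add_right_injective J).tsum_eq fun k hk ↦ ?_).symm
  have : J ≤ k := by
    by_contra hJ
    exact hk (h k (not_le.1 hJ))
  exact ⟨k - J, by simp [this]⟩

/-- The double series giving the density of the composition of two operators. -/
lemma tsum_tsum_szk_eq {m n x t : ℝ} (hm : 0 < m) (hn : 0 < n) (hx : 0 ≤ x) (ht : 0 ≤ t) (i : ℕ) :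
    ∑' (a : ℕ) (b : ℕ), ENNReal.ofReal (szk m (i + a : ℕ) x * (n * szk n b t) *
        (m ^ (a + 1) * n ^ (i + b) * (a + (i + b)).factorial /
          (a.factorial * (i + b).factorial * (m + n) ^ (a + (i + b) + 1)))) =
      ∑' r : ℕ, ENNReal.ofReal (m * n / (m + n) * (m * n / (m + n) * x) ^ i *
        ((m * n / (m + n)) ^ 2 * x * t) ^ r / (r.factorial * (i + r).factorial) *
        Real.exp (-(m * n / (m + n)) * (x + t))) := by
  set X := m ^ 2 * x / (m + n) with hX
  set T := n ^ 2 * t / (m + n) with hT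
  set E := m * n / (m + n) * (m * n / (m + n) * x) ^ i * Real.exp (-m * x) * Real.exp (-n * t)
    with hE
  have hX0 : 0 ≤ X := by positivity
  have hT0 : 0 ≤ T := by positivity
  have hE0 : 0 ≤ E := by positivity
  let w : ℕ → ℕ → ℕ → ℝ := fun r u v ↦
    E * X ^ (r + u) * T ^ (r + v) *
      (1 / (r.factorial * (i + r).factorial * (u.factorial * v.factorial)))
  have key : ∀ a b : ℕ, ENNReal.ofReal (szk m (i + a : ℕ) x * (n * szk n b t) *
        (m ^ (a + 1) * n ^ (i + b) * (a + (i + b)).factorial /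
          (a.factorial * (i + b).factorial * (m + n) ^ (a + (i + b) + 1)))) =
      ∑' r : ℕ, if r ≤ a ∧ r ≤ b then ENNReal.ofReal (w r (a - r) (b - r)) else 0 := by
    intro a b
    rw [tsum_eq_sum (s := Finset.range (b + 1)) (fun r hr ↦ if_neg (by simp at hr; omega))]
    have e1 : szk m (i + a : ℕ) x * (n * szk n b t) *
        (m ^ (a + 1) * n ^ (i + b) * (a + (i + b)).factorial /
          (a.factorial * (i + b).factorial * (m + n) ^ (a + (i + b) + 1))) =
        E * X ^ a * T ^ b * ((a + (i + b)).factorial /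
        (a.factorial * (i + b).factorial * ((i + a).factorial * b.factorial))) := by
      rw [szk_natCast, szk_natCast, hE, hX, hT]
      simp only [div_pow, mul_pow, pow_add, pow_one, ← pow_mul]
      field_simp
      ring
    rw [e1, ← sum_range_inv_factorial_eq, Finset.mul_sum, ENNReal.ofReal_sum_of_nonneg]
    · refine Finset.sum_congr rfl fun r _ ↦ ?_
      split_ifs with h
      · simp only [w]
        rw [Nat.add_sub_cancel' h.1, Nat.add_sub_cancel' h.2]
      · simp
    · intro r _
      split_ifs <;> positivity
  simp_rw [key]
  have shift : ∀ r : ℕ, ∑' (a : ℕ) (b : ℕ),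
      (if r ≤ a ∧ r ≤ b then ENNReal.ofReal (w r (a - r) (b - r)) else 0) =
      ∑' (u : ℕ) (v : ℕ), ENNReal.ofReal (w r u v) := by
    intro r
    rw [ENNReal.tsum_eq_tsum_add_of_eq_zero r (fun a ha ↦ by simp [not_le.2 ha])]
    refine tsum_congr fun u ↦ ?_
    rw [ENNReal.tsum_eq_tsum_add_of_eq_zero r (fun b hb ↦ by simp [not_le.2 hb])]
    simp
  calc _ = ∑' (a : ℕ) (r : ℕ) (b : ℕ),
        (if r ≤ a ∧ r ≤ b then ENNReal.ofReal (w r (a - r) (b - r)) else 0) :=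
      tsum_congr fun a ↦ ENNReal.tsum_comm
    _ = ∑' (r : ℕ) (u : ℕ) (v : ℕ), ENNReal.ofReal (w r u v) := by
      rw [ENNReal.tsum_comm]
      exact tsum_congr shift
    _ = _ := by
      refine tsum_congr fun r ↦ ?_
      have e : ∀ u v, ENNReal.ofReal (w r u v) =
          ENNReal.ofReal (E * (X * T) ^ r / (r.factorial * (i + r).factorial)) *
            (ENNReal.ofReal (X ^ u / u.factorial) * ENNReal.ofReal (T ^ v / v.factorial)) := by
        intro u v
        rw [← ENNReal.ofReal_mul (by positivity), ← ENNReal.ofReal_mul (by positivity)]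
        congr 1
        simp only [w, mul_pow, pow_add]
        field_simp
      simp_rw [e, ENNReal.tsum_mul_left, tsum_ofReal_pow_div_factorial hT0, ENNReal.tsum_mul_right,
        tsum_ofReal_pow_div_factorial hX0]
      rw [← ENNReal.ofReal_mul (by positivity), ← ENNReal.ofReal_mul (by positivity)]
      congr 1
      have e2 : Real.exp (-(m * n / (m + n)) * (x + t)) =
          Real.exp (-m * x) * Real.exp (-n * t) * (Real.exp X * Real.exp T) := by
        rw [← Real.exp_add, ← Real.exp_add, ← Real.exp_add]
        congr 1
        rw [hX, hT]
        field_simp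
        ring
      have e3 : X * T = (m * n / (m + n)) ^ 2 * x * t := by
        rw [hX, hT]
        field_simp
      rw [e2, e3, hE]
      ring

/-- The double series of `tsum_tsum_szk_eq` is symmetric in `m` and `n`. -/
lemma tsum_tsum_szk_comm {m n x t : ℝ} (hm : 0 < m) (hn : 0 < n) (hx : 0 ≤ x) (ht : 0 ≤ t)
    (i : ℕ) :
    ∑' (a : ℕ) (b : ℕ), ENNReal.ofReal (szk m (i + a : ℕ) x * (n * szk n b t) *
        (m ^ (a + 1) * n ^ (i + b) * (a + (i + b)).factorial /
          (a.factorial * (i + b).factorial * (m + n) ^ (a + (i + b) + 1)))) =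
      ∑' (a : ℕ) (b : ℕ), ENNReal.ofReal (szk n (i + a : ℕ) x * (m * szk m b t) *
        (n ^ (a + 1) * m ^ (i + b) * (a + (i + b)).factorial /
          (a.factorial * (i + b).factorial * (n + m) ^ (a + (i + b) + 1)))) := by
  rw [tsum_tsum_szk_eq hm hn hx ht, tsum_tsum_szk_eq hn hm hx ht, mul_comm n m, add_comm n m]

/-- The functionals `f ↦ n ∫ s_{n,k-j} f` (or `f ↦ f 0` if `k < j`), as measures. -/
noncomputable def szkMeasure (n : ℝ) (j k : ℤ) : Measure ℝ :=
  if k < j then Measure.dirac 0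
  else (volume.restrict (Set.Ioi 0)).withDensity fun t ↦ ENNReal.ofReal (n * szk n (k - j) t)

lemma szkMeasure_of_lt {j k : ℤ} (n : ℝ) (h : k < j) : szkMeasure n j k = Measure.dirac 0 :=
  if_pos h

lemma szkMeasure_of_le {j k : ℤ} (n : ℝ) (h : j ≤ k) :
    szkMeasure n j k =
      (volume.restrict (Set.Ioi 0)).withDensity fun t ↦ ENNReal.ofReal (n * szk n (k - j) t) :=
  if_neg (not_lt.2 h)

lemma lintegral_szkMeasure_of_le {j k : ℤ} (n : ℝ) (h : j ≤ k) {g : ℝ → ℝ≥0∞}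
    (hg : Measurable g) :
    ∫⁻ t, g t ∂szkMeasure n j k =
      ∫⁻ t in Set.Ioi (0 : ℝ), ENNReal.ofReal (n * szk n (k - j) t) * g t := by
  rw [szkMeasure_of_le n h, lintegral_withDensity_eq_lintegral_mul _ (by fun_prop) hg]
  rfl

lemma lintegral_exp_szkMeasure {n B : ℝ} (hn : 0 ≤ n) (hB : B < n) (j k : ℤ) :
    ∫⁻ t, ENNReal.ofReal (Real.exp (B * t)) ∂szkMeasure n j k =
      ENNReal.ofReal ((n / (n - B)) ^ (k - j + 1).toNat) := by
  by_cases h : k < j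
  · rw [szkMeasure_of_lt n h, lintegral_dirac, Int.toNat_of_nonpos (by omega)]
    simp
  · obtain ⟨i, hi⟩ := Int.eq_ofNat_of_zero_le (show 0 ≤ k - j by omega)
    rw [lintegral_szkMeasure_of_le n (not_lt.1 h) (by fun_prop), hi, lintegral_szk_mul_exp hn hB]
    rfl

lemma isProbabilityMeasure_szkMeasure {n : ℝ} (hn : 0 < n) (j k : ℤ) :
    IsProbabilityMeasure (szkMeasure n j k) := by
  constructor
  simpa [hn.ne'] using lintegral_exp_szkMeasure hn.le hn j k

/-- The operator `S_{n,j}` as a kernel: `S_{n,j} f x` is the integral of `f` against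
`szkKernel n j x`, for `x ≥ 0`. -/
noncomputable def szkKernel (n : ℝ) (j : ℤ) : Kernel ℝ ℝ where
  toFun x := Measure.sum fun k : ℕ ↦ ENNReal.ofReal (szk n k (max x 0)) • szkMeasure n j k
  measurable' := by
    refine Measure.measurable_of_measurable_coe _ fun s hs ↦ ?_
    simp only [Measure.sum_apply _ hs, Measure.smul_apply, smul_eq_mul]
    exact Measurable.tsum fun k ↦ by fun_prop

lemma szkKernel_apply {n x : ℝ} (j : ℤ) (hx : 0 ≤ x) :
    szkKernel n j x =
      Measure.sum fun k : ℕ ↦ ENNReal.ofReal (szk n k x) • szkMeasure n j k := by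
  simp [szkKernel, hx]

lemma szkKernel_apply_apply {n x : ℝ} (j : ℤ) (hx : 0 ≤ x) {s : Set ℝ} (hs : MeasurableSet s) :
    szkKernel n j x s = ∑' k : ℕ, ENNReal.ofReal (szk n k x) * szkMeasure n j k s := by
  simp [szkKernel_apply j hx, Measure.sum_apply _ hs]

lemma lintegral_szkKernel {n x : ℝ} (j : ℤ) (hx : 0 ≤ x) (g : ℝ → ℝ≥0∞) :
    ∫⁻ t, g t ∂szkKernel n j x =
      ∑' k : ℕ, ENNReal.ofReal (szk n k x) * ∫⁻ t, g t ∂szkMeasure n j k := by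
  simp [szkKernel_apply j hx, lintegral_sum_measure, lintegral_smul_measure]

lemma isMarkovKernel_szkKernel {n : ℝ} (hn : 0 < n) (j : ℤ) : IsMarkovKernel (szkKernel n j) := by
  refine ⟨fun x ↦ ⟨?_⟩⟩
  have := isProbabilityMeasure_szkMeasure hn j
  change Measure.sum _ _ = _
  simp [Measure.sum_apply, tsum_ofReal_szk hn.le]

lemma szkKernel_absolutelyContinuous (n x : ℝ) (j : ℤ) :
    szkKernel n j x ≪ Measure.dirac 0 + volume.restrict (Set.Ioi 0) := by
  change Measure.sum _ ≪ _
  refine Measure.absolutelyContinuous_sum_left fun k ↦ ?_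
  refine Measure.AbsolutelyContinuous.smul_left ?_ _
  by_cases h : (k : ℤ) < j
  · rw [szkMeasure_of_lt n h]
    exact Measure.absolutelyContinuous_of_le (Measure.le_add_right le_rfl)
  · rw [szkMeasure_of_le n (not_lt.1 h)]
    exact (withDensity_absolutelyContinuous _ _).trans
      (Measure.absolutelyContinuous_of_le (Measure.le_add_left le_rfl))

lemma comp_szkKernel_absolutelyContinuous (m n x : ℝ) (j : ℤ) :
    (szkKernel n j ∘ₖ szkKernel m j) x ≪ Measure.dirac 0 + volume.restrict (Set.Ioi 0) := by
  refine Measure.AbsolutelyContinuous.mk fun s hs h ↦ ?_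
  rw [Kernel.comp_apply' _ _ _ hs]
  simp [szkKernel_absolutelyContinuous n _ j h]

lemma ae_nonneg_of_absolutelyContinuous {μ : Measure ℝ}
    (h : μ ≪ Measure.dirac 0 + volume.restrict (Set.Ioi 0)) : ∀ᵐ t ∂μ, 0 ≤ t := by
  refine h.ae_le ?_
  change {t : ℝ | 0 ≤ t} ∈ ae _
  rw [mem_ae_iff]
  have : {t : ℝ | 0 ≤ t}ᶜ = Set.Iio 0 := by ext; simp
  rw [this, Measure.add_apply, Measure.dirac_apply' _ measurableSet_Iio,
    Measure.restrict_apply measurableSet_Iio]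
  simp [Set.Iio_inter_Ioi]

lemma lintegral_exp_szkKernel_le {n B x : ℝ} (hB0 : 0 ≤ B) (hB : B < n) (hx : 0 ≤ x) (j : ℤ) :
    ∫⁻ t, ENNReal.ofReal (Real.exp (B * t)) ∂szkKernel n j x ≤
      ENNReal.ofReal ((n / (n - B)) ^ (1 - j).toNat) *
        ENNReal.ofReal (Real.exp (n * B / (n - B) * x)) := by
  have hn : 0 ≤ n := hB0.trans hB.le
  have hb : 0 < n - B := sub_pos.2 hB
  have hr : 1 ≤ n / (n - B) := by rw [one_le_div hb]; linarith
  rw [lintegral_szkKernel j hx, show n * B / (n - B) * x = n * x * (n / (n - B) - 1) by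
    field_simp; ring, ← tsum_ofReal_szk_mul_pow hn hx (zero_le_one.trans hr),
    ← ENNReal.tsum_mul_left]
  refine ENNReal.tsum_le_tsum fun k ↦ ?_
  rw [lintegral_exp_szkMeasure hn hB, mul_left_comm,
    ← ENNReal.ofReal_mul (p := (n / (n - B)) ^ (1 - j).toNat) (by positivity), ← pow_add]
  gcongr
  omega

/-- On `(0,∞)` the composition of two kernels has an explicit density. -/
lemma comp_szkKernel_apply {m n x : ℝ} (hm : 0 < m) (hn : 0 < n) (hx : 0 ≤ x) (j : ℤ) {s : Set ℝ}
    (hs : MeasurableSet s) (hs0 : s ⊆ Set.Ioi 0) :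
    (szkKernel n j ∘ₖ szkKernel m j) x s = ∫⁻ t in s, ∑' (a : ℕ) (b : ℕ),
      ENNReal.ofReal (szk m (j.toNat + a : ℕ) x * (n * szk n ((-j).toNat + b : ℕ) t) *
        (m ^ ((-j).toNat + a + 1) * n ^ (j.toNat + b) *
            ((-j).toNat + a + (j.toNat + b)).factorial /
          (((-j).toNat + a).factorial * (j.toNat + b).factorial *
            (m + n) ^ ((-j).toNat + a + (j.toNat + b) + 1)))) := by
  have hj (a : ℕ) : ((j.toNat + a : ℕ) : ℤ) - j = ((-j).toNat + a : ℕ) := by omega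
  have hle (a : ℕ) : j ≤ (j.toNat + a : ℕ) := by omega
  have hlt {k : ℕ} (hk : k < j.toNat) : (k : ℤ) < j := by omega
  have h0 {k : ℕ} (hk : k < j.toNat) : szkMeasure n j k s = 0 := by
    rw [szkMeasure_of_lt n (hlt hk), Measure.dirac_apply' _ hs]
    simpa using fun h ↦ lt_irrefl (0 : ℝ) (hs0 h)
  have hν (b : ℕ) : szkMeasure n j (j.toNat + b : ℕ) s =
      ∫⁻ t in s, ENNReal.ofReal (n * szk n ((-j).toNat + b : ℕ) t) := by
    rw [szkMeasure_of_le n (hle b), withDensity_apply _ hs, Measure.restrict_restrict hs,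
      Set.inter_eq_left.2 hs0, hj]
  have hP {y : ℝ} (hy : 0 ≤ y) : szkKernel n j y s =
      ∑' b : ℕ, ENNReal.ofReal (szk n (j.toNat + b : ℕ) y) *
        szkMeasure n j (j.toNat + b : ℕ) s := by
    rw [szkKernel_apply_apply j hy hs,
      ENNReal.tsum_eq_tsum_add_of_eq_zero j.toNat fun k hk ↦ by rw [h0 hk, mul_zero]]
  have hc (a b : ℕ) : ∫⁻ y, ENNReal.ofReal (szk n (j.toNat + b : ℕ) y)
      ∂szkMeasure m j (j.toNat + a : ℕ) = ENNReal.ofReal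
        (m ^ ((-j).toNat + a + 1) * n ^ (j.toNat + b) *
            ((-j).toNat + a + (j.toNat + b)).factorial /
          (((-j).toNat + a).factorial * (j.toNat + b).factorial *
            (m + n) ^ ((-j).toNat + a + (j.toNat + b) + 1))) := by
    rw [lintegral_szkMeasure_of_le m (hle a) (by fun_prop), hj, lintegral_szk_mul_szk hm hn]
  rw [Kernel.comp_apply' _ _ _ hs, lintegral_congr_ae
    (ae_nonneg_of_absolutelyContinuous (szkKernel_absolutelyContinuous m x j) |>.mono
      fun y hy ↦ hP hy), lintegral_szkKernel j hx,
    ENNReal.tsum_eq_tsum_add_of_eq_zero j.toNat fun k hk ↦ ?_]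
  · have meas (a b : ℕ) : Measurable fun t ↦
        ENNReal.ofReal (szk m (j.toNat + a : ℕ) x * (n * szk n ((-j).toNat + b : ℕ) t) *
        (m ^ ((-j).toNat + a + 1) * n ^ (j.toNat + b) *
            ((-j).toNat + a + (j.toNat + b)).factorial /
          (((-j).toNat + a).factorial * (j.toNat + b).factorial *
            (m + n) ^ ((-j).toNat + a + (j.toNat + b) + 1)))) := by fun_prop
    rw [lintegral_tsum fun a ↦ (Measurable.tsum (meas a)).aemeasurable]
    refine tsum_congr fun a ↦ ?_
    rw [lintegral_tsum fun b ↦ (meas a b).aemeasurable,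
      lintegral_tsum fun b ↦ by fun_prop, ← ENNReal.tsum_mul_left]
    refine tsum_congr fun b ↦ ?_
    rw [lintegral_mul_const _ (by fun_prop), hc, hν, ← lintegral_const_mul _ (by fun_prop),
      ← lintegral_const_mul _ (by fun_prop)]
    refine setLIntegral_congr_fun hs fun t ht ↦ ?_
    have ht0 : 0 ≤ t := (hs0 ht).le
    have h1 := szk_nonneg hm.le hx (j.toNat + a : ℕ)
    have h2 := szk_nonneg hn.le ht0 ((-j).toNat + b : ℕ)
    rw [← ENNReal.ofReal_mul (by positivity), ← ENNReal.ofReal_mul (by positivity)]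
    congr 1
    ring
  · rw [szkMeasure_of_lt m (hlt hk), lintegral_dirac]
    have : ∀ b : ℕ, szk n (j.toNat + b : ℕ) 0 = 0 := fun b ↦ by
      rw [szk_natCast, mul_zero, zero_pow (by omega)]
      simp
    simp only [this, ENNReal.ofReal_zero, zero_mul, tsum_zero, mul_zero]

lemma comp_szkKernel_comm_apply {m n x : ℝ} (hm : 0 < m) (hn : 0 < n) (hx : 0 ≤ x) (j : ℤ)
    {s : Set ℝ} (hs : MeasurableSet s) (hs0 : s ⊆ Set.Ioi 0) :
    (szkKernel n j ∘ₖ szkKernel m j) x s = (szkKernel m j ∘ₖ szkKernel n j) x s := by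
  rw [comp_szkKernel_apply hm hn hx j hs hs0, comp_szkKernel_apply hn hm hx j hs hs0]
  refine setLIntegral_congr_fun hs fun t ht ↦ ?_
  have ht0 : 0 ≤ t := (hs0 ht).le
  rcases le_total 0 j with h | h
  · rw [show (-j).toNat = 0 by omega]
    simpa only [zero_add] using tsum_tsum_szk_comm hm hn hx ht0 j.toNat
  · rw [show j.toNat = 0 by omega]
    have key := tsum_tsum_szk_comm hn hm ht0 hx (-j).toNat
    rw [ENNReal.tsum_comm, ENNReal.tsum_comm (f := fun a b : ℕ ↦ ENNReal.ofReal
      (szk m ((-j).toNat + a : ℕ) t * (n * szk n b x) * _))] at key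
    simp only [zero_add]
    convert key using 5 with a b a b
    · rw [add_comm m n, add_comm ((-j).toNat + a) b]
      congr 1
      ring
    · rw [add_comm m n, add_comm ((-j).toNat + a) b]
      congr 1
      ring

lemma Measure.eq_of_apply_subset_Ioi {μ ν : Measure ℝ} [IsProbabilityMeasure μ]
    [IsProbabilityMeasure ν] (hμ : ∀ᵐ t ∂μ, 0 ≤ t) (hν : ∀ᵐ t ∂ν, 0 ≤ t)
    (h : ∀ s, MeasurableSet s → s ⊆ Set.Ioi 0 → μ s = ν s) : μ = ν := by
  have hIic : μ (Set.Iic 0) = ν (Set.Iic 0) := by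
    rw [← Set.compl_Ioi, prob_compl_eq_one_sub measurableSet_Ioi,
      prob_compl_eq_one_sub measurableSet_Ioi, h _ measurableSet_Ioi subset_rfl]
  ext s hs
  rw [← measure_inter_add_sdiff s (measurableSet_Ioi (a := (0 : ℝ))),
    ← measure_inter_add_sdiff (μ := ν) s (measurableSet_Ioi (a := (0 : ℝ))),
    h _ (hs.inter measurableSet_Ioi) Set.inter_subset_right]
  congr 1
  by_cases h0 : (0 : ℝ) ∈ s
  · have aux {ρ : Measure ℝ} (hρ : ∀ᵐ t ∂ρ, 0 ≤ t) : ρ (s \ Set.Ioi 0) = ρ (Set.Iic 0) := by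
      refine measure_congr (hρ.mono fun t ht ↦ propext ⟨fun hts ↦ not_lt.1 hts.2, fun hts ↦ ?_⟩)
      obtain rfl : t = 0 := le_antisymm hts ht
      exact ⟨h0, lt_irrefl (0 : ℝ)⟩
    rw [aux hμ, aux hν, hIic]
  · have aux {ρ : Measure ℝ} (hρ : ∀ᵐ t ∂ρ, 0 ≤ t) : ρ (s \ Set.Ioi 0) = 0 := by
      refine measure_mono_null (fun t ht (ht' : 0 ≤ t) ↦ h0 ?_) (ae_iff.1 hρ)
      obtain rfl : t = 0 := le_antisymm (not_lt.1 ht.2) ht'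
      exact ht.1
    rw [aux hμ, aux hν]

lemma comp_szkKernel_comm {m n x : ℝ} (hm : 0 < m) (hn : 0 < n) (hx : 0 ≤ x) (j : ℤ) :
    (szkKernel n j ∘ₖ szkKernel m j) x = (szkKernel m j ∘ₖ szkKernel n j) x := by
  have := isMarkovKernel_szkKernel hm j
  have := isMarkovKernel_szkKernel hn j
  exact Measure.eq_of_apply_subset_Ioi
    (ae_nonneg_of_absolutelyContinuous (comp_szkKernel_absolutelyContinuous m n x j))
    (ae_nonneg_of_absolutelyContinuous (comp_szkKernel_absolutelyContinuous n m x j))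
    fun s hs hs0 ↦ comp_szkKernel_comm_apply hm hn hx j hs hs0

/-- `S_{n,j} f` is an integral against `szkKernel n j`. -/
lemma Snj_eq_integral {n x : ℝ} (hn : 0 < n) (hx : 0 ≤ x) (j : ℤ) {f : ℝ → ℝ}
    (hf : Integrable f (szkKernel n j x)) : Snj n j f x = ∫ t, f t ∂szkKernel n j x := by
  rw [szkKernel_apply j hx] at hf ⊢
  have h := hasSum_integral_measure hf
  simp only [integral_smul_measure, ENNReal.toReal_ofReal (szk_nonneg hn.le hx _),
    smul_eq_mul] at h
  rw [← h.tsum_eq, ← h.summable.sum_add_tsum_nat_add j.toNat, Snj, Finset.mul_sum]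
  congr 1
  · refine Finset.sum_congr rfl fun k hk ↦ ?_
    rw [szkMeasure_of_lt n (by simp at hk; omega), integral_dirac, mul_comm]
  · refine tsum_congr fun k ↦ ?_
    have e : max 0 j + (k : ℤ) = (k + j.toNat : ℕ) := by omega
    rw [e, szkMeasure_of_le n (by omega),
      integral_withDensity_eq_integral_toReal_smul (by fun_prop) (by simp),
      ← integral_const_mul]
    congr 1
    refine setIntegral_congr_fun measurableSet_Ioi fun t ht ↦ ?_
    simp only [smul_eq_mul]
    rw [ENNReal.toReal_ofReal (mul_nonneg hn.le (szk_nonneg hn.le (le_of_lt ht) _)), mul_assoc]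

lemma MemEA.aestronglyMeasurable {A : ℝ} {f : ℝ → ℝ} (hf : MemEA A f) :
    AEStronglyMeasurable f (Measure.dirac 0 + volume.restrict (Set.Ioi 0)) :=
  aestronglyMeasurable_dirac.add_measure
    (hf.1.aestronglyMeasurable.mono_set Set.Ioi_subset_Ici_self)

lemma MemEA.enorm_le {A : ℝ} {f : ℝ → ℝ} (hf : MemEA A f) :
    ∃ K : ℝ≥0∞, K ≠ ∞ ∧ ∀ t ≥ (0 : ℝ), ‖f t‖ₑ ≤ K * ENNReal.ofReal (Real.exp (A * t)) := by
  obtain ⟨-, K, hK, h⟩ := hf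
  refine ⟨ENNReal.ofReal K, ENNReal.ofReal_ne_top, fun t ht ↦ ?_⟩
  rw [← ENNReal.ofReal_mul hK.le, Real.enorm_eq_ofReal_abs]
  exact ENNReal.ofReal_le_ofReal (h t ht)

lemma MemEA.lintegral_enorm_le {A n : ℝ} {f : ℝ → ℝ} (hf : MemEA A f) (hA : 0 ≤ A) (hn : A < n)
    (j : ℤ) : ∃ K : ℝ≥0∞, K ≠ ∞ ∧ ∀ x ≥ (0 : ℝ), ∫⁻ t, ‖f t‖ₑ ∂szkKernel n j x ≤
      K * ENNReal.ofReal (Real.exp (n * A / (n - A) * x)) := by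
  obtain ⟨K, hK, h⟩ := hf.enorm_le
  refine ⟨K * ENNReal.ofReal ((n / (n - A)) ^ (1 - j).toNat),
    ENNReal.mul_ne_top hK ENNReal.ofReal_ne_top, fun x hx ↦ ?_⟩
  calc _ ≤ ∫⁻ t, K * ENNReal.ofReal (Real.exp (A * t)) ∂szkKernel n j x :=
        lintegral_mono_ae ((ae_nonneg_of_absolutelyContinuous
          (szkKernel_absolutelyContinuous n x j)).mono h)
    _ ≤ _ := by
      rw [lintegral_const_mul _ (by fun_prop), mul_assoc]
      gcongr
      exact lintegral_exp_szkKernel_le hA hn hx j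

lemma MemEA.integrable_szkKernel {A n x : ℝ} {f : ℝ → ℝ} (hf : MemEA A f) (hA : 0 ≤ A)
    (hn : A < n) (hx : 0 ≤ x) (j : ℤ) : Integrable f (szkKernel n j x) := by
  obtain ⟨K, hK, h⟩ := hf.lintegral_enorm_le hA hn j
  exact ⟨hf.aestronglyMeasurable.mono_ac (szkKernel_absolutelyContinuous n x j),
    (h x hx).trans_lt (ENNReal.mul_lt_top hK.lt_top ENNReal.ofReal_lt_top)⟩

lemma MemEA.integrable_comp_szkKernel {A m n x : ℝ} {f : ℝ → ℝ} (hf : MemEA A f) (hA : 0 ≤ A)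
    (hn : 2 * A < n) (hm : 2 * A < m) (hx : 0 ≤ x) (j : ℤ) :
    Integrable f ((szkKernel n j ∘ₖ szkKernel m j) x) := by
  have hA' : 0 < n - A := by linarith
  obtain ⟨K, hK, h⟩ := hf.lintegral_enorm_le (n := n) hA (by linarith) j
  have hmeas := hf.aestronglyMeasurable.mono_ac (comp_szkKernel_absolutelyContinuous m n x j)
  have hB0 : 0 ≤ n * A / (n - A) := div_nonneg (mul_nonneg (by linarith) hA) hA'.le
  have hB : n * A / (n - A) < m := by
    refine lt_of_le_of_lt ?_ hm
    rw [div_le_iff₀ hA']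
    nlinarith
  refine ⟨hmeas, ?_⟩
  rw [HasFiniteIntegral, Kernel.comp_apply, Measure.lintegral_bind (Kernel.aemeasurable _)
    (by simpa only [Kernel.comp_apply] using hmeas.enorm)]
  calc _ ≤ ∫⁻ y, K * ENNReal.ofReal (Real.exp (n * A / (n - A) * y)) ∂szkKernel m j x :=
        lintegral_mono_ae ((ae_nonneg_of_absolutelyContinuous
          (szkKernel_absolutelyContinuous m x j)).mono h)
    _ < ∞ := by
      rw [lintegral_const_mul _ (by fun_prop)]
      exact ENNReal.mul_lt_top hK.lt_top ((lintegral_exp_szkKernel_le hB0 hB hx j).trans_lt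
        (ENNReal.mul_lt_top ENNReal.ofReal_lt_top ENNReal.ofReal_lt_top))

lemma Snj_Snj_eq_integral {A m n x : ℝ} {f : ℝ → ℝ} (hf : MemEA A f) (hA : 0 ≤ A)
    (hn : 2 * A < n) (hm : 2 * A < m) (hx : 0 ≤ x) (j : ℤ) :
    Snj m j (Snj n j f) x = ∫ t, f t ∂(szkKernel n j ∘ₖ szkKernel m j) x := by
  have hn0 : 0 < n := by linarith
  have hm0 : 0 < m := by linarith
  have := isMarkovKernel_szkKernel hm0 j
  have := isMarkovKernel_szkKernel hn0 j
  have hint := hf.integrable_comp_szkKernel hA hn hm hx j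
  have hae : Snj n j f =ᵐ[szkKernel m j x] fun y ↦ ∫ t, f t ∂szkKernel n j y :=
    (ae_nonneg_of_absolutelyContinuous (szkKernel_absolutelyContinuous m x j)).mono
      fun y hy ↦ Snj_eq_integral hn0 hy j (hf.integrable_szkKernel hA (by linarith) hy j)
  rw [Snj_eq_integral hm0 hx j (hint.integral_comp.congr hae.symm), integral_congr_ae hae,
    Kernel.integral_comp hint]

/-- Commutativity: `S_{m,j}(S_{n,j} f) = S_{n,j}(S_{m,j} f)` on `[0,∞)` for `n, m > 2A`. -/
theorem commutativity_Snj (j : ℤ) (A : ℝ) (hA : 0 ≤ A) (f : ℝ → ℝ) (hf : MemEA A f)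
    (n m : ℝ) (hn : n > 2 * A) (hm : m > 2 * A) :
    ∀ x ≥ (0:ℝ), Snj m j (Snj n j f) x = Snj n j (Snj m j f) x := by
  intro x hx
  rw [Snj_Snj_eq_integral hf hA hn hm hx, Snj_Snj_eq_integral hf hA hm hn hx,
    comp_szkKernel_comm (by linarith) (by linarith) hx]
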